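/- Let G be a finite simple graph, Γ ⊆ Ω(G) nonempty, and let Γ' be a nonempty subfamily of MaxCritIndep(G) such that for every A ∈ Γ' there exists S ∈ Γ with A ⊆ S. If ⋂Γ is a critical set, then |⋂Γ'| + |⋃Γ'| ≤ |⋂Γ| + |⋃Γ|. -/

import Mathlib

/-- `S` is an independent set in `G`: no two of its vertices are adjacent. -/
def IndepSet {V : Type*} (G : SimpleGraph V) (S : Set V) : Prop :=
  ∀ ⦃u⦄, u ∈ S → ∀ ⦃v⦄, v ∈ S → ¬G.Adj u v

/-- The independence number `α(G)`. -/
noncomputable def indNum {V : Type*} (G : SimpleGraph V) : ℕ :=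
  sSup {n : ℕ | ∃ S : Set V, IndepSet G S ∧ S.ncard = n}

/-- `Ω(G)`: the family of maximum independent sets of `G`. -/
def maxIndepFam {V : Type*} (G : SimpleGraph V) : Set (Set V) :=
  {S | IndepSet G S ∧ S.ncard = indNum G}

/-- `N(X)`: the neighborhood of a set of vertices. -/
def nbhd {V : Type*} (G : SimpleGraph V) (X : Set V) : Set V :=
  {v | ∃ x ∈ X, G.Adj v x}

/-- `N[X] = N(X) ∪ X`: the closed neighborhood of a set of vertices. -/
def closedNbhd {V : Type*} (G : SimpleGraph V) (X : Set V) : Set V :=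
  nbhd G X ∪ X

/-- The difference `d(X) = |X| - |N(X)|`. -/
noncomputable def diffd {V : Type*} (G : SimpleGraph V) (X : Set V) : ℤ :=
  (X.ncard : ℤ) - ((nbhd G X).ncard : ℤ)

/-- The critical difference `d(G) = max {d(X) : X ⊆ V(G)}`. -/
noncomputable def critDiff {V : Type*} (G : SimpleGraph V) : ℤ :=
  sSup {d : ℤ | ∃ X : Set V, diffd G X = d}

/-- `X` is a critical set if `d(X) = d(G)`. -/
def IsCritical {V : Type*} (G : SimpleGraph V) (X : Set V) : Prop :=
  diffd G X = critDiff G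

/-- `MaxCritIndep(G)`: the family of critical independent sets of maximum cardinality. -/
def maxCritIndepFam {V : Type*} (G : SimpleGraph V) : Set (Set V) :=
  {S | IndepSet G S ∧ IsCritical G S ∧
    ∀ T : Set V, IndepSet G T → IsCritical G T → T.ncard ≤ S.ncard}

/-- The critical independence number `α'(G)`. -/
noncomputable def critIndNum {V : Type*} (G : SimpleGraph V) : ℕ :=
  sSup {n : ℕ | ∃ S : Set V, IndepSet G S ∧ IsCritical G S ∧ S.ncard = n}

/-- `ker(G)`: the intersection of all critical independent sets. -/
def kerSet {V : Type*} (G : SimpleGraph V) : Set V :=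
  ⋂₀ {A : Set V | IndepSet G A ∧ IsCritical G A}

/-- `nucleus(G)`: the intersection of all maximum critical independent sets. -/
def nucleus {V : Type*} (G : SimpleGraph V) : Set V :=
  ⋂₀ maxCritIndepFam G

/-- `diadem(G)`: the union of all maximum critical independent sets. -/
def diadem {V : Type*} (G : SimpleGraph V) : Set V :=
  ⋃₀ maxCritIndepFam G

/-- `core(G)`: the intersection of all maximum independent sets. -/
def coreSet {V : Type*} (G : SimpleGraph V) : Set V :=
  ⋂₀ maxIndepFam G

/-- `corona(G)`: the union of all maximum independent sets. -/
def coronaSet {V : Type*} (G : SimpleGraph V) : Set V :=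
  ⋃₀ maxIndepFam G

/-- A matching in `G`: a set of pairwise non-incident edges of `G`. -/
def IsMatchingSet {V : Type*} (G : SimpleGraph V) (M : Set (Sym2 V)) : Prop :=
  M ⊆ G.edgeSet ∧ M.Pairwise fun e f => ∀ v, v ∈ e → v ∉ f

/-- The matching number `μ(G)`. -/
noncomputable def matchNum {V : Type*} (G : SimpleGraph V) : ℕ :=
  sSup {n : ℕ | ∃ M : Set (Sym2 V), IsMatchingSet G M ∧ M.ncard = n}

/-- `G` is a König-Egerváry graph if `α(G) + μ(G) = |V(G)|`. -/
def IsKonigEgervary {V : Type*} (G : SimpleGraph V) : Prop :=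
  indNum G + matchNum G = Nat.card V

/-- `Γ` is a König-Egerváry collection: a family of independent sets with
`|⋂Γ| + |⋃Γ| = 2α(G)`. -/
def IsKECollection {V : Type*} (G : SimpleGraph V) (Γ : Set (Set V)) : Prop :=
  (∀ S ∈ Γ, IndepSet G S) ∧ (⋂₀ Γ).ncard + (⋃₀ Γ).ncard = 2 * indNum G

section Criticality

variable {V : Type*} {G : SimpleGraph V} {A B : Set V} {Γ : Set (Set V)}

theorem nbhd_union (A B : Set V) : nbhd G (A ∪ B) = nbhd G A ∪ nbhd G B := by
  ext v
  simp [nbhd, or_and_right, exists_or]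

theorem IndepSet.disjoint_nbhd (hA : IndepSet G A) : Disjoint A (nbhd G A) :=
  Set.disjoint_left.2 fun _ hv ⟨_, hx, h⟩ => hA hv hx h

theorem IndepSet.union_diff_nbhd (hA : IndepSet G A) (hB : IndepSet G B) :
    IndepSet G (A ∪ (B \ nbhd G A)) := by
  rintro u (hu | hu) v (hv | hv) h
  · exact hA hu hv h
  · exact hv.2 ⟨u, hu, h.symm⟩
  · exact hu.2 ⟨v, hv, h⟩
  · exact hB hu.1 hv.1 h

variable [Fintype V]

theorem diffd_le_critDiff (X : Set V) : diffd G X ≤ critDiff G :=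
  le_csSup (Set.finite_range (diffd G)).bddAbove ⟨X, rfl⟩

theorem IndepSet.ncard_le_indNum (hA : IndepSet G A) : A.ncard ≤ indNum G := by
  refine le_csSup ⟨Nat.card V, ?_⟩ ⟨A, hA, rfl⟩
  rintro _ ⟨S, -, rfl⟩
  exact Set.ncard_le_card S

/-- The difference function is supermodular. -/
theorem diffd_add_le (A B : Set V) :
    diffd G A + diffd G B ≤ diffd G (A ∪ B) + diffd G (A ∩ B) := by
  have h₁ := Set.ncard_union_add_ncard_inter A B
  have h₂ := Set.ncard_union_add_ncard_inter (nbhd G A) (nbhd G B)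
  have h₃ : (nbhd G (A ∩ B)).ncard ≤ (nbhd G A ∩ nbhd G B).ncard :=
    Set.ncard_le_ncard fun v ⟨x, hx, hv⟩ => ⟨⟨x, hx.1, hv⟩, ⟨x, hx.2, hv⟩⟩
  simp only [diffd, nbhd_union]
  omega

theorem IsCritical.union (hA : IsCritical G A) (hB : IsCritical G B) :
    IsCritical G (A ∪ B) := by
  have h₁ := diffd_add_le (G := G) A B
  have h₂ := diffd_le_critDiff (G := G) (A ∩ B)
  have h₃ := diffd_le_critDiff (G := G) (A ∪ B)
  unfold IsCritical at *
  omega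

theorem IsCritical.ncard_nbhd_inter_le (hA : IsCritical G A) (B : Set V) :
    (nbhd G A ∩ B).ncard ≤ (A ∩ nbhd G B).ncard := by
  have h₁ := diffd_le_critDiff (G := G) (A \ nbhd G B)
  have h₂ : (nbhd G (A \ nbhd G B)).ncard ≤ (nbhd G A \ B).ncard :=
    Set.ncard_le_ncard fun v ⟨x, hx, hv⟩ => ⟨⟨x, hx.1, hv⟩, fun hvB => hx.2 ⟨v, hvB, hv.symm⟩⟩
  have h₃ := Set.ncard_inter_add_ncard_sdiff_eq_ncard A (nbhd G B)
  have h₄ := Set.ncard_inter_add_ncard_sdiff_eq_ncard (nbhd G A) B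
  unfold IsCritical at hA
  unfold diffd at *
  omega

theorem IsCritical.union_diff_nbhd (hA : IsCritical G A) (hB : IsCritical G B)
    (hiA : IndepSet G A) : IsCritical G (A ∪ (B \ nbhd G A)) := by
  refine le_antisymm (diffd_le_critDiff _) ?_
  have h₁ : critDiff G = diffd G (A ∪ B) := (hA.union hB).symm
  have h₂ := hA.ncard_nbhd_inter_le B
  have h₃ : (A ∪ B).ncard ≤ (A ∪ (B \ nbhd G A)).ncard + (nbhd G A ∩ B).ncard := by
    refine (Set.ncard_le_ncard fun v hv => ?_).trans (Set.ncard_union_le _ _)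
    by_cases v ∈ nbhd G A <;> simp_all
  have h₄ : (nbhd G (A ∪ (B \ nbhd G A))).ncard + (A ∩ nbhd G B).ncard
      ≤ (nbhd G (A ∪ B)).ncard := by
    rw [← Set.ncard_union_eq]
    · refine Set.ncard_le_ncard ?_
      rintro v (⟨x, hx, hv⟩ | ⟨-, x, hx, hv⟩)
      · exact ⟨x, hx.imp id And.left, hv⟩
      · exact ⟨x, .inr hx, hv⟩
    · refine Set.disjoint_left.2 ?_
      rintro v ⟨x, hx | hx, hv⟩ ⟨hvA, -⟩
      · exact hiA hvA hx hv
      · exact hx.2 ⟨v, hvA, hv.symm⟩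
  unfold diffd at *
  omega

/-- A maximum critical independent set and its neighborhood absorb every critical
independent set. -/
theorem subset_closedNbhd_of_mem_maxCritIndepFam (hA : A ∈ maxCritIndepFam G)
    (hiB : IndepSet G B) (hB : IsCritical G B) : B ⊆ closedNbhd G A := by
  have h := Set.eq_of_subset_of_ncard_le (Set.subset_union_left (s := A) (t := B \ nbhd G A))
    (hA.2.2 _ (hA.1.union_diff_nbhd hiB) (hA.2.1.union_diff_nbhd hB hA.1))
  intro v hv
  by_cases hvA : v ∈ nbhd G A
  · exact .inl hvA
  · exact .inr (h ▸ .inr ⟨hv, hvA⟩)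

theorem nbhd_subset_closedNbhd_of_mem_maxCritIndepFam (hA : A ∈ maxCritIndepFam G)
    (hiB : IndepSet G B) (hB : IsCritical G B) : nbhd G B ⊆ closedNbhd G A := by
  have h₁ : diffd G (A ∪ B) = diffd G A := (hA.2.1.union hB).trans hA.2.1.symm
  have h₂ := hA.2.1.ncard_nbhd_inter_le B
  have h₃ : (A ∪ B).ncard ≤ A.ncard + (nbhd G A ∩ B).ncard := by
    refine (Set.ncard_le_ncard ?_).trans (Set.ncard_union_le _ _)
    rintro v (hv | hv)
    · exact .inl hv
    · exact (subset_closedNbhd_of_mem_maxCritIndepFam hA hiB hB hv).elim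
        (fun h => .inr ⟨h, hv⟩) .inl
  have h₄ : Disjoint (A ∩ nbhd G B) (nbhd G A) := hA.1.disjoint_nbhd.mono_left
    Set.inter_subset_left
  have h₅ := Set.ncard_union_eq h₄
  have h₆ : A ∩ nbhd G B ∪ nbhd G A = nbhd G (A ∪ B) := by
    refine Set.eq_of_subset_of_ncard_le ?_ ?_
    · rw [nbhd_union]
      exact Set.union_subset (fun v hv => .inr hv.2) Set.subset_union_left
    · unfold diffd at h₁
      omega
  intro v hv
  have hv' : v ∈ nbhd G (A ∪ B) := by
    rw [nbhd_union]
    exact .inr hv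
  rw [← h₆] at hv'
  exact hv'.elim (fun h => .inr h.1) .inl

theorem ncard_sInter_add_ncard_sUnion_le (hΓ : Γ ⊆ maxCritIndepFam G) (hA : A ∈ Γ) :
    (⋂₀ Γ).ncard + (⋃₀ Γ).ncard ≤ 2 * A.ncard := by
  have h₁ : Disjoint (⋂₀ Γ) (nbhd G (⋃₀ Γ)) := by
    refine Set.disjoint_left.2 ?_
    rintro v hv ⟨x, ⟨B, hB, hx⟩, h⟩
    exact (hΓ hB).1 (hv B hB) hx h
  have h₂ : ⋂₀ Γ ∪ nbhd G (⋃₀ Γ) ⊆ closedNbhd G A := by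
    rintro v (hv | ⟨x, ⟨B, hB, hx⟩, h⟩)
    · exact .inr (hv A hA)
    · exact nbhd_subset_closedNbhd_of_mem_maxCritIndepFam (hΓ hA) (hΓ hB).1 (hΓ hB).2.1 ⟨x, hx, h⟩
  have h₃ := (Set.ncard_le_ncard h₂).trans (Set.ncard_union_le _ _)
  rw [Set.ncard_union_eq h₁] at h₃
  have h₄ : diffd G (⋃₀ Γ) ≤ diffd G A := (diffd_le_critDiff _).trans_eq (hΓ hA).2.1.symm
  unfold diffd at h₄
  omega

theorem two_mul_indNum_le (hne : Γ.Nonempty) (hΓ : Γ ⊆ maxIndepFam G) :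
    2 * indNum G ≤ (⋂₀ Γ).ncard + (⋃₀ Γ).ncard := by
  induction Γ, Γ.toFinite using Set.Finite.induction_on with
  | empty => exact absurd hne Set.not_nonempty_empty
  | @insert T Δ _ _ ih =>
    have hT := hΓ (Set.mem_insert T Δ)
    have hΔ := (Set.subset_insert T Δ).trans hΓ
    rcases Δ.eq_empty_or_nonempty with rfl | ⟨S, hS⟩
    · simp [hT.2, two_mul]
    have ih := ih ⟨S, hS⟩ hΔ
    have hind : IndepSet G (T ∩ ⋃₀ Δ ∪ ⋂₀ Δ) := by
      rintro u (⟨hu, B, hB, huB⟩ | hu) v (⟨hv, C, hC, hvC⟩ | hv)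
      · exact hT.1 hu hv
      · exact (hΔ hB).1 huB (hv B hB)
      · exact (hΔ hC).1 (hu C hC) hvC
      · exact (hΔ hS).1 (hu S hS) (hv S hS)
    have h₁ := hind.ncard_le_indNum
    have h₂ : T ∩ ⋃₀ Δ ∩ ⋂₀ Δ = T ∩ ⋂₀ Δ := by
      rw [Set.inter_assoc, Set.inter_eq_right.2 ((Set.sInter_subset_of_mem hS).trans
        (Set.subset_sUnion_of_mem hS))]
    have h₃ := Set.ncard_union_add_ncard_inter (T ∩ ⋃₀ Δ) (⋂₀ Δ)
    have h₄ := Set.ncard_union_add_ncard_inter T (⋃₀ Δ)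
    have h₅ := hT.2
    rw [h₂] at h₃
    rw [Set.sInter_insert, Set.sUnion_insert]
    omega

end Criticality

/-- If `Γ ⊆ Ω(G)` is nonempty, `Γ'` is a nonempty subfamily of
`MaxCritIndep(G)` such that every `A ∈ Γ'` is contained in some `S ∈ Γ`, and `⋂Γ` is a
critical set, then `|⋂Γ'| + |⋃Γ'| ≤ |⋂Γ| + |⋃Γ|`. -/
theorem stmt8 {V : Type*} [Fintype V] (G : SimpleGraph V)
    (Γ Γ' : Set (Set V)) (hne : Γ.Nonempty) (hΓ : Γ ⊆ maxIndepFam G)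
    (hne' : Γ'.Nonempty) (hΓ' : Γ' ⊆ maxCritIndepFam G)
    (hcov : ∀ A ∈ Γ', ∃ S ∈ Γ, A ⊆ S)
    (hcrit : IsCritical G (⋂₀ Γ)) :
    (⋂₀ Γ').ncard + (⋃₀ Γ').ncard ≤ (⋂₀ Γ).ncard + (⋃₀ Γ).ncard := by
  obtain ⟨A, hA⟩ := hne'
  have h₁ := ncard_sInter_add_ncard_sUnion_le hΓ' hA
  have h₂ := (hΓ' hA).1.ncard_le_indNum
  have h₃ := two_mul_indNum_le hne hΓ
  omega
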